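/- Let γ > 0 and let T be a proximal-gradient map for (f, g, γ). Then for all x, y ∈ ℝⁿ: F(T x) + ((1 − γL)/(2γ))·‖T x − x‖² + (1/(2γ))·‖T x − y‖² ≤ F(y) + (1/(2γ))·‖x − y‖². -/

import Mathlib

open scoped RealInnerProductSpace

section ProximalGradient

variable {E : Type*} [NormedAddCommGroup E] [InnerProductSpace ℝ E]

theorem HasGradientAt.hasDerivAt_comp_add_smul [CompleteSpace E] {f : E → ℝ} {f' x d : E} {t : ℝ}
    (hf : HasGradientAt f f' (x + t • d)) :
    HasDerivAt (fun s : ℝ => f (x + s • d)) ⟪f', d⟫ t := by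
  have hline : HasDerivAt (fun s : ℝ => x + s • d) d t := by
    simpa using ((hasDerivAt_id t).smul_const d).const_add x
  simpa [Function.comp_def] using hf.hasFDerivAt.comp_hasDerivAt t hline

/-- The first-order characterization of convexity. -/
theorem ConvexOn.add_inner_gradient_le [CompleteSpace E] {f : E → ℝ} {f' x : E}
    (hf : ConvexOn ℝ Set.univ f) (hf' : HasGradientAt f f' x) (y : E) :
    f x + ⟪f', y - x⟫ ≤ f y := by
  have hconv : ConvexOn ℝ Set.univ (fun s : ℝ => f (x + s • (y - x))) := by
    refine ⟨convex_univ, fun a _ b _ u v hu hv huv => ?_⟩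
    have h := hf.2 (Set.mem_univ (x + a • (y - x))) (Set.mem_univ (x + b • (y - x))) hu hv huv
    convert h using 2
    rw [← eq_sub_iff_add_eq] at huv
    subst huv
    simp only [smul_eq_mul]
    module
  have hderiv : HasDerivAt (fun s : ℝ => f (x + s • (y - x))) ⟪f', y - x⟫ 0 :=
    HasGradientAt.hasDerivAt_comp_add_smul (by simpa using hf')
  have h := hconv.le_slope_of_hasDerivAt (Set.mem_univ 0) (Set.mem_univ 1) one_pos hderiv
  simp [slope_def_field] at h
  linarith

/-- The descent lemma: a function with `L`-Lipschitz gradient lies below its quadratic model. -/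
theorem le_quadratic_of_lipschitz_gradient [CompleteSpace E] {f : E → ℝ} {f' : E → E} {L : ℝ}
    (hf : ∀ x, HasGradientAt f (f' x) x) (hL : ∀ x y, ‖f' x - f' y‖ ≤ L * ‖x - y‖) (x y : E) :
    f y ≤ f x + ⟪f' x, y - x⟫ + L / 2 * ‖y - x‖ ^ 2 := by
  set d := y - x with hd
  let φ : ℝ → ℝ := fun t => f (x + t • d) - (t * ⟪f' x, d⟫ + t ^ 2 * (L / 2 * ‖d‖ ^ 2))
  have hφ (t : ℝ) :
      HasDerivAt φ (⟪f' (x + t • d), d⟫ - (⟪f' x, d⟫ + 2 * t * (L / 2 * ‖d‖ ^ 2))) t := by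
    refine (hf _).hasDerivAt_comp_add_smul.sub (HasDerivAt.add ?_ ?_)
    · simpa using (hasDerivAt_id t).mul_const ⟪f' x, d⟫
    · simpa using (hasDerivAt_pow 2 t).mul_const (L / 2 * ‖d‖ ^ 2)
  have hanti : AntitoneOn φ (Set.Icc 0 1) := by
    refine antitoneOn_of_deriv_nonpos (convex_Icc 0 1)
      (fun t _ => (hφ t).continuousAt.continuousWithinAt)
      (fun t _ => (hφ t).differentiableAt.differentiableWithinAt) fun t ht => ?_
    rw [interior_Icc] at ht
    have hlip : ‖f' (x + t • d) - f' x‖ ≤ L * (t * ‖d‖) := by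
      simpa [norm_smul, abs_of_pos ht.1] using hL (x + t • d) x
    have hcs := (real_inner_le_norm (f' (x + t • d) - f' x) d).trans
      (mul_le_mul_of_nonneg_right hlip (norm_nonneg d))
    rw [inner_sub_left] at hcs
    rw [(hφ t).deriv]
    linarith
  have h := hanti (Set.left_mem_Icc.2 zero_le_one) (Set.right_mem_Icc.2 zero_le_one) zero_le_one
  simp only [φ, one_smul, zero_smul, add_zero, hd, add_sub_cancel] at h
  linarith

/-- The three-point inequality for a minimizer `p` of `w ↦ g w + c * ‖w - z‖ ^ 2`. -/
theorem ConvexOn.add_sq_norm_le_of_isMin_prox {g : E → ℝ} (hg : ConvexOn ℝ Set.univ g)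
    {c : ℝ} {p z : E} (hp : ∀ w, g p + c * ‖p - z‖ ^ 2 ≤ g w + c * ‖w - z‖ ^ 2) (y : E) :
    g p + c * ‖p - z‖ ^ 2 + c * ‖p - y‖ ^ 2 ≤ g y + c * ‖y - z‖ ^ 2 := by
  have hstep : ∀ t ∈ Set.Ioo (0 : ℝ) 1,
      g p ≤ g y + 2 * c * ⟪p - z, y - p⟫ + t * (c * ‖y - p‖ ^ 2) := by
    intro t ht
    have hconv := hg.2 (Set.mem_univ p) (Set.mem_univ y) (sub_nonneg.2 ht.2.le) ht.1.le
      (sub_add_cancel 1 t)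
    have hmin := hp ((1 - t) • p + t • y)
    have hw : (1 - t) • p + t • y - z = (p - z) + t • (y - p) := by module
    rw [hw, norm_add_sq_real, inner_smul_right, norm_smul, Real.norm_of_nonneg ht.1.le] at hmin
    simp only [smul_eq_mul] at hconv
    refine le_of_mul_le_mul_left ?_ ht.1
    linarith
  have hlim : g p ≤ g y + 2 * c * ⟪p - z, y - p⟫ := by
    have htend : Filter.Tendsto
        (fun t : ℝ => g y + 2 * c * ⟪p - z, y - p⟫ + t * (c * ‖y - p‖ ^ 2))
        (nhdsWithin 0 (Set.Ioi 0)) (nhds (g y + 2 * c * ⟪p - z, y - p⟫)) := by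
      refine Filter.Tendsto.mono_left ?_ nhdsWithin_le_nhds
      exact Continuous.tendsto' (by fun_prop) _ _ (by simp)
    exact ge_of_tendsto htend (Filter.eventually_of_mem (Ioo_mem_nhdsGT one_pos) hstep)
  have hexp : ‖y - z‖ ^ 2 = ‖p - z‖ ^ 2 + 2 * ⟪p - z, y - p⟫ + ‖p - y‖ ^ 2 := by
    rw [norm_sub_rev p y, ← norm_add_sq_real, add_comm, sub_add_sub_cancel]
  rw [hexp]
  linarith

end ProximalGradient

theorem stmt_1
    (n : ℕ) (hn : 0 < n)
    (L γ : ℝ) (hL : 0 < L) (hγ : 0 < γ)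
    (f g : EuclideanSpace ℝ (Fin n) → ℝ)
    (f' : EuclideanSpace ℝ (Fin n) → EuclideanSpace ℝ (Fin n))
    (hf_conv : ConvexOn ℝ Set.univ f)
    (hf_diff : ∀ x, HasGradientAt f (f' x) x)
    (hf_lip : ∀ x y, ‖f' x - f' y‖ ≤ L * ‖x - y‖)
    (hg_conv : ConvexOn ℝ Set.univ g)
    (hmin : ∃ z, ∀ w, f z + g z ≤ f w + g w)
    (T : EuclideanSpace ℝ (Fin n) → EuclideanSpace ℝ (Fin n))
    (hT : ∀ x w, g (T x) + (1 / (2 * γ)) * ‖T x - (x - γ • f' x)‖ ^ 2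
        ≤ g w + (1 / (2 * γ)) * ‖w - (x - γ • f' x)‖ ^ 2) :
    ∀ x y, (f (T x) + g (T x)) + ((1 - γ * L) / (2 * γ)) * ‖T x - x‖ ^ 2
        + (1 / (2 * γ)) * ‖T x - y‖ ^ 2
      ≤ (f y + g y) + (1 / (2 * γ)) * ‖x - y‖ ^ 2 := by
  intro x y
  have hdesc := le_quadratic_of_lipschitz_gradient hf_diff hf_lip x (T x)
  have hgrad := hf_conv.add_inner_gradient_le (hf_diff x) y
  have hprox := hg_conv.add_sq_norm_le_of_isMin_prox (hT x) y
  have hexp (w : EuclideanSpace ℝ (Fin n)) :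
      1 / (2 * γ) * ‖w - (x - γ • f' x)‖ ^ 2 =
        1 / (2 * γ) * ‖w - x‖ ^ 2 + ⟪f' x, w - x⟫ + γ / 2 * ‖f' x‖ ^ 2 := by
    have hw : w - (x - γ • f' x) = (w - x) + γ • f' x := by module
    rw [hw, norm_add_sq_real, inner_smul_right, norm_smul, Real.norm_of_nonneg hγ.le,
      real_inner_comm]
    field_simp
  have hcoef : (1 - γ * L) / (2 * γ) = 1 / (2 * γ) - L / 2 := by field_simp
  rw [hexp, hexp] at hprox
  rw [hcoef, norm_sub_rev x y]
  linarith
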